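/- arXiv:2404.08846 — 4 statements merged into one kernel-verified Lean document; each statement's English description precedes it below -/
import Mathlib

section
/- Let d, n, K, T be positive integers, let x_1, …, x_n ∈ ℝ^d (training examples) and x_{*,1}, …, x_{*,K} ∈ ℝ^d (test examples) all be unit vectors. For each k ∈ {1,…,K} let S_k ⊆ ℝ^d be a convex set with x_{*,k} ∈ S_k, and let α_k, β_k ≥ 0 be such that uᵀv ≥ α_k for all u, v ∈ S_k and uᵀw ≤ β_k for all u ∈ S_k and all training examples w ∉ S_k. Put α = min_k α_k, β = max_k β_k and S = ∩_{k=1}^K S_k, and assume: more than T of the training examples lie in S, β ≥ 1 − α², and T ≤ α² / ((β + √2) β d). Suppose X_1, …, X_T are chosen by the greedy G-optimal rule: writing Λ_t = I_d + Σ_{ℓ=1}^{t−1} X_ℓ X_ℓᵀ, at each round t ∈ {1,…,T} the vector X_t is a previously unchosen training example minimizing max_{k∈[K]} x_{*,k}ᵀ (Λ_t + x xᵀ)^{-1} x_{*,k} over all previously unchosen training examples x. Then for every k ∈ {1,…,K}, x_{*,k}ᵀ Λ_{T+1}^{-1} x_{*,k} ≤ 1/(α² T + 1) + (1 − α²). 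-/
open Matrix

section

variable {m : Type*} [Fintype m]

lemma Matrix.IsSymm.dotProduct_mulVec_comm {A : Matrix m m ℝ} (hA : A.IsSymm) (y z : m → ℝ) :
    y ⬝ᵥ A *ᵥ z = z ⬝ᵥ A *ᵥ y := by
  rw [dotProduct_mulVec, ← mulVec_transpose, hA.eq, dotProduct_comm]

lemma sq_dotProduct_le_one {y z : m → ℝ} (hy : y ⬝ᵥ y = 1) (hz : z ⬝ᵥ z = 1) :
    (y ⬝ᵥ z) ^ 2 ≤ 1 := by
  have h := Finset.sum_mul_sq_le_sq_mul_sq Finset.univ y z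
  simp only [dotProduct, ← sq] at *
  rwa [hy, hz, one_mul] at h

variable [DecidableEq m]

lemma mulVec_inv_mulVec {A : Matrix m m ℝ} (hA : IsUnit A.det) (y : m → ℝ) :
    A *ᵥ (A⁻¹ *ᵥ y) = y := by
  rw [mulVec_mulVec, mul_nonsing_inv _ hA, one_mulVec]

lemma inv_mulVec_mulVec {A : Matrix m m ℝ} (hA : IsUnit A.det) (y : m → ℝ) :
    A⁻¹ *ᵥ (A *ᵥ y) = y := by
  rw [mulVec_mulVec, nonsing_inv_mul _ hA, one_mulVec]

/-- If `A ≥ 1` in the Loewner order, then `A⁻¹ ≤ 1`. -/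
lemma dotProduct_inv_mulVec_le {A : Matrix m m ℝ} (hA : IsUnit A.det)
    (hA1 : ∀ y, y ⬝ᵥ y ≤ y ⬝ᵥ A *ᵥ y) (e : m → ℝ) : e ⬝ᵥ A⁻¹ *ᵥ e ≤ e ⬝ᵥ e := by
  set y := A⁻¹ *ᵥ e with hy
  have h1 := hA1 y
  rw [hy, mulVec_inv_mulVec hA, ← hy, dotProduct_comm y e] at h1
  have h2 : 0 ≤ (e - y) ⬝ᵥ (e - y) := by
    simpa using dotProduct_star_self_nonneg (e - y)
  simp only [sub_dotProduct, dotProduct_sub, dotProduct_comm y e] at h2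
  linarith

lemma one_div_le_dotProduct_inv_mulVec {A : Matrix m m ℝ} (hsymm : A.IsSymm)
    (hA : IsUnit A.det) (hA1 : ∀ y, y ⬝ᵥ y ≤ y ⬝ᵥ A *ᵥ y) {u : m → ℝ} (hu : u ⬝ᵥ u = 1)
    {c : ℝ} (hc : 0 < c) (huc : u ⬝ᵥ A *ᵥ u ≤ c) : 1 / c ≤ u ⬝ᵥ A⁻¹ *ᵥ u := by
  set z := A⁻¹ *ᵥ u with hz
  have hAz : A *ᵥ z = u := mulVec_inv_mulVec hA u
  have h0 : 0 ≤ (z - (1 / c) • u) ⬝ᵥ (z - (1 / c) • u) := by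
    simpa using dotProduct_star_self_nonneg (z - (1 / c) • u)
  have h1 := h0.trans (hA1 (z - (1 / c) • u))
  simp only [mulVec_sub, mulVec_smul, sub_dotProduct, dotProduct_sub, smul_dotProduct,
    dotProduct_smul, smul_eq_mul, hsymm.dotProduct_mulVec_comm z u, hAz, hu,
    dotProduct_comm z u] at h1
  have h2 : 1 / c * (1 / c * (u ⬝ᵥ A *ᵥ u)) ≤ 1 / c := by
    calc 1 / c * (1 / c * (u ⬝ᵥ A *ᵥ u)) ≤ 1 / c * (1 / c * c) := by gcongr
      _ = 1 / c := by field_simp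
  linarith

/-- A rank-one update of the precision matrix shrinks the variance in the direction `x`
(Sherman–Morrison). -/
lemma dotProduct_inv_add_vecMulVec_mulVec {A : Matrix m m ℝ} (hsymm : A.IsSymm)
    (hA : IsUnit A.det) {u : m → ℝ} (hAu : IsUnit (A + vecMulVec u u).det)
    (hp : 1 + u ⬝ᵥ A⁻¹ *ᵥ u ≠ 0) (x : m → ℝ) :
    x ⬝ᵥ (A + vecMulVec u u)⁻¹ *ᵥ x =
      x ⬝ᵥ A⁻¹ *ᵥ x - (u ⬝ᵥ A⁻¹ *ᵥ x) ^ 2 / (1 + u ⬝ᵥ A⁻¹ *ᵥ u) := by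
  have hsymm' : (A⁻¹).IsSymm := by
    rw [Matrix.IsSymm, transpose_nonsing_inv, hsymm.eq]
  set p := u ⬝ᵥ A⁻¹ *ᵥ u with hpdef
  set c := u ⬝ᵥ A⁻¹ *ᵥ x with hcdef
  have key : (A + vecMulVec u u) *ᵥ (A⁻¹ *ᵥ x - (c / (1 + p)) • (A⁻¹ *ᵥ u)) = x := by
    rw [add_mulVec, vecMulVec_mulVec, mulVec_sub, mulVec_smul, mulVec_inv_mulVec hA,
      mulVec_inv_mulVec hA, dotProduct_sub, dotProduct_smul, ← hpdef, ← hcdef]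
    ext i
    simp only [Pi.add_apply, Pi.sub_apply, Pi.smul_apply, smul_eq_mul, op_smul_eq_smul]
    field_simp
    ring
  have hinv := inv_mulVec_mulVec hAu (A⁻¹ *ᵥ x - (c / (1 + p)) • (A⁻¹ *ᵥ u))
  rw [key] at hinv
  rw [hinv, dotProduct_sub, dotProduct_smul,
    hsymm'.dotProduct_mulVec_comm x u, ← hcdef, smul_eq_mul]
  ring

/-- Observing a unit vector `u` whose inner product with the unit vector `x` is at least `a`
contracts the excess of the variance at `x` over `1 - a ^ 2`. -/
lemma dotProduct_inv_add_vecMulVec_mulVec_le {A : Matrix m m ℝ} (hsymm : A.IsSymm)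
    (hA : IsUnit A.det) (hA1 : ∀ y, y ⬝ᵥ y ≤ y ⬝ᵥ A *ᵥ y) {u x : m → ℝ}
    (hAu : IsUnit (A + vecMulVec u u).det) (hu : u ⬝ᵥ u = 1) (hx : x ⬝ᵥ x = 1)
    {a c r : ℝ} (ha : 0 ≤ a) (hux : a ≤ u ⬝ᵥ x) (hc : 0 < c) (huc : u ⬝ᵥ A *ᵥ u ≤ c)
    (hr : 0 ≤ r) (hxr : x ⬝ᵥ A⁻¹ *ᵥ x ≤ r / c + (1 - a ^ 2)) :
    x ⬝ᵥ (A + vecMulVec u u)⁻¹ *ᵥ x ≤ r / (c + 1) + (1 - a ^ 2) := by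
  have hsymm' : (A⁻¹).IsSymm := by
    rw [Matrix.IsSymm, transpose_nonsing_inv, hsymm.eq]
  have hp := one_div_le_dotProduct_inv_mulVec hsymm hA hA1 hu hc huc
  have hE := dotProduct_inv_mulVec_le hA hA1 (x - (u ⬝ᵥ x) • u)
  simp only [mulVec_sub, mulVec_smul, sub_dotProduct, dotProduct_sub, smul_dotProduct,
    dotProduct_smul, smul_eq_mul, hsymm'.dotProduct_mulVec_comm x u, hu, hx,
    dotProduct_comm x u] at hE
  have hp0 : 0 < u ⬝ᵥ A⁻¹ *ᵥ u := lt_of_lt_of_le (by positivity) hp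
  rw [dotProduct_inv_add_vecMulVec_mulVec hsymm hA hAu (by positivity)]
  generalize u ⬝ᵥ A⁻¹ *ᵥ u = p at *
  generalize u ⬝ᵥ A⁻¹ *ᵥ x = q at *
  generalize x ⬝ᵥ A⁻¹ *ᵥ x = v at *
  generalize u ⬝ᵥ x = w at *
  have haw : a ^ 2 ≤ w ^ 2 := by gcongr
  have hvE : v - 2 * w * q + w ^ 2 * p ≤ 1 - a ^ 2 := by linarith
  have hq : p * (v - (1 - a ^ 2)) ≤ q ^ 2 := by
    nlinarith [sq_nonneg (q - w * p), mul_le_mul_of_nonneg_left hvE hp0.le]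
  calc v - q ^ 2 / (1 + p) ≤ v - p * (v - (1 - a ^ 2)) / (1 + p) := by gcongr
    _ = (v - (1 - a ^ 2)) / (1 + p) + (1 - a ^ 2) := by field_simp; ring
    _ ≤ (r / c) / (1 + p) + (1 - a ^ 2) := by gcongr; linarith
    _ ≤ (r / c) / (1 + 1 / c) + (1 - a ^ 2) := by gcongr
    _ = r / (c + 1) + (1 - a ^ 2) := by field_simp

lemma dotProduct_one_add_sum_vecMulVec_mulVec {κ : Type*} (s : Finset κ) (X : κ → m → ℝ)
    (y : m → ℝ) :
    y ⬝ᵥ (1 + ∑ i ∈ s, vecMulVec (X i) (X i)) *ᵥ y = y ⬝ᵥ y + ∑ i ∈ s, (X i ⬝ᵥ y) ^ 2 := by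
  rw [add_mulVec, one_mulVec, dotProduct_add, sum_mulVec, dotProduct_sum]
  congr 1
  refine Finset.sum_congr rfl fun i _ => ?_
  rw [vecMulVec_mulVec, op_smul_eq_smul, dotProduct_smul, smul_eq_mul, dotProduct_comm y, sq]

lemma posDef_one_add_sum_vecMulVec {κ : Type*} (s : Finset κ) (X : κ → m → ℝ) :
    (1 + ∑ i ∈ s, vecMulVec (X i) (X i)).PosDef :=
  PosDef.one.add_posSemidef (posSemidef_sum s fun i _ => by
    simpa using posSemidef_vecMulVec_self_star (X i))

end

/-- **Theorem 1 (guarantee for the greedy G-optimal design GO).**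
Let `d, n, K, T` be positive integers, `x_1, …, x_n ∈ ℝ^d` unit training examples and
`x_{*,1}, …, x_{*,K} ∈ ℝ^d` unit test examples. For each `k` let `S_k ⊆ ℝ^d` be convex
with `x_{*,k} ∈ S_k`, and `α_k, β_k ≥ 0` with `uᵀv ≥ α_k` for all `u, v ∈ S_k` and
`uᵀw ≤ β_k` for all `u ∈ S_k` and training examples `w ∉ S_k`. Put `a = min_k α_k`,
`b = max_k β_k`, `S = ∩_k S_k`, and assume more than `T` training examples lie in `S`,
`b ≥ 1 − a²`, and `T ≤ a² / ((b + √2) b d)`. If `X_t = x_{ι(t)}` are chosen by the greedy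
G-optimal rule (with `Λ_t = I + Σ_{ℓ<t} X_ℓ X_ℓᵀ`, each `X_t` a previously unchosen
training example minimizing `max_k x_{*,k}ᵀ (Λ_t + x xᵀ)⁻¹ x_{*,k}` among previously
unchosen training examples), then for every `k`,
`x_{*,k}ᵀ Λ_{T+1}⁻¹ x_{*,k} ≤ 1/(a² T + 1) + (1 − a²)`. -/
theorem stmt_0 {d n K T : ℕ} (hd : 0 < d) (hn : 0 < n) (hK : 0 < K) (hT : 0 < T)
    (x : Fin n → Fin d → ℝ) (xs : Fin K → Fin d → ℝ)
    (hxunit : ∀ i, x i ⬝ᵥ x i = 1) (hxsunit : ∀ k, xs k ⬝ᵥ xs k = 1)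
    (S : Fin K → Set (Fin d → ℝ)) (hSconv : ∀ k, Convex ℝ (S k))
    (hxsS : ∀ k, xs k ∈ S k)
    (α β : Fin K → ℝ) (hα0 : ∀ k, 0 ≤ α k) (hβ0 : ∀ k, 0 ≤ β k)
    (hclose : ∀ k, ∀ u ∈ S k, ∀ v ∈ S k, α k ≤ u ⬝ᵥ v)
    (hfar : ∀ k, ∀ u ∈ S k, ∀ i : Fin n, x i ∉ S k → u ⬝ᵥ x i ≤ β k)
    (a b : ℝ) (ha : a = ⨅ k, α k) (hb : b = ⨆ k, β k)
    (hcard : T < {i : Fin n | x i ∈ ⋂ k, S k}.ncard)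
    (hba : b ≥ 1 - a ^ 2)
    (hTb : (T : ℝ) ≤ a ^ 2 / ((b + Real.sqrt 2) * b * d))
    (ι : Fin T → Fin n) (hιinj : Function.Injective ι)
    (Λ : ℕ → Matrix (Fin d) (Fin d) ℝ)
    (hΛ : ∀ t : ℕ, Λ t = 1 + ∑ s ∈ Finset.univ.filter (fun s : Fin T => (s : ℕ) < t),
      vecMulVec (x (ι s)) (x (ι s)))
    (hgreedy : ∀ t : Fin T, ∀ j : Fin n, (∀ s : Fin T, (s : ℕ) < (t : ℕ) → ι s ≠ j) →
      (⨆ k, xs k ⬝ᵥ (Λ t + vecMulVec (x (ι t)) (x (ι t)))⁻¹ *ᵥ xs k) ≤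
        ⨆ k, xs k ⬝ᵥ (Λ t + vecMulVec (x j) (x j))⁻¹ *ᵥ xs k) :
    ∀ k, xs k ⬝ᵥ (Λ T)⁻¹ *ᵥ xs k ≤ 1 / (a ^ 2 * T + 1) + (1 - a ^ 2) := by
  have hKne : Nonempty (Fin K) := ⟨⟨0, hK⟩⟩
  obtain ⟨j, hjS, hjι⟩ : ∃ j, x j ∈ ⋂ k, S k ∧ j ∉ Set.range ι := by
    have hlt : (Set.range ι).ncard < {i : Fin n | x i ∈ ⋂ k, S k}.ncard := by
      rwa [← Set.image_univ, Set.ncard_image_of_injective _ hιinj, Set.ncard_univ,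
        Nat.card_eq_fintype_card, Fintype.card_fin]
    exact Set.exists_mem_notMem_of_ncard_lt_ncard hlt
  have ha0 : 0 ≤ a := ha ▸ le_ciInf hα0
  have hax : ∀ k, a ≤ x j ⬝ᵥ xs k := fun k =>
    (ha ▸ ciInf_le (Set.finite_range α).bddBelow k : a ≤ α k).trans
      (hclose k _ (Set.mem_iInter.1 hjS k) _ (hxsS k))
  have hΛpos : ∀ t, (Λ t).PosDef := fun t => hΛ t ▸ posDef_one_add_sum_vecMulVec _ _
  have hΛsymm : ∀ t, (Λ t).IsSymm := fun t => by
    simpa [Matrix.IsHermitian, Matrix.IsSymm] using (hΛpos t).isHermitian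
  have hΛquad : ∀ t y, y ⬝ᵥ Λ t *ᵥ y = y ⬝ᵥ y +
      ∑ s ∈ Finset.univ.filter (fun s : Fin T => (s : ℕ) < t), (x (ι s) ⬝ᵥ y) ^ 2 := fun t y => by
    rw [hΛ, dotProduct_one_add_sum_vecMulVec_mulVec _ (fun s => x (ι s))]
  have hΛone : ∀ t y, y ⬝ᵥ y ≤ y ⬝ᵥ Λ t *ᵥ y := fun t y => by
    rw [hΛquad]
    exact le_add_of_nonneg_right (Finset.sum_nonneg fun _ _ => sq_nonneg _)
  have hΛle : ∀ t ≤ T, x j ⬝ᵥ Λ t *ᵥ x j ≤ t + 1 := fun t ht => by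
    have hcard : (Finset.univ.filter (fun s : Fin T => (s : ℕ) < t)).card = t := by
      rw [Fin.card_filter_val_lt, min_eq_right ht]
    have hsum := Finset.sum_le_card_nsmul
      (Finset.univ.filter (fun s : Fin T => (s : ℕ) < t)) (fun s => (x (ι s) ⬝ᵥ x j) ^ 2) 1
      fun s _ => sq_dotProduct_le_one (hxunit _) (hxunit _)
    rw [hcard, nsmul_one] at hsum
    rw [hΛquad, hxunit]
    linarith
  have hΛsucc : ∀ t : Fin T, Λ (t + 1) = Λ t + vecMulVec (x (ι t)) (x (ι t)) := fun t => by
    have hfilter : Finset.univ.filter (fun s : Fin T => (s : ℕ) < t + 1) =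
        insert t (Finset.univ.filter (fun s : Fin T => (s : ℕ) < t)) := by
      ext s
      simp [Fin.ext_iff]
      omega
    rw [hΛ, hΛ, hfilter, Finset.sum_insert (by simp)]
    abel
  have hvar : ∀ t ≤ T, ∀ k, xs k ⬝ᵥ (Λ t)⁻¹ *ᵥ xs k ≤ a ^ 2 / (t + 1) + (1 - a ^ 2) := by
    intro t
    induction t with
    | zero => intro _ k; simp [hΛ, hxsunit]
    | succ t ih =>
      intro ht k
      have hupdate : (Λ t + vecMulVec (x j) (x j)).PosDef :=
        (hΛpos t).add_posSemidef (by simpa using posSemidef_vecMulVec_self_star (x j))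
      rw [hΛsucc ⟨t, ht⟩]
      push_cast
      refine ((le_ciSup (f := fun k => xs k ⬝ᵥ (Λ t + vecMulVec (x (ι ⟨t, ht⟩))
        (x (ι ⟨t, ht⟩)))⁻¹ *ᵥ xs k) (Set.finite_range _).bddAbove k).trans
        (hgreedy ⟨t, ht⟩ j fun s _ hs => hjι ⟨s, hs⟩)).trans (ciSup_le fun k => ?_)
      exact dotProduct_inv_add_vecMulVec_mulVec_le (hΛsymm t) (hΛpos t).det_pos.ne'.isUnit
        (hΛone t) hupdate.det_pos.ne'.isUnit (hxunit j) (hxsunit k) ha0 (hax k)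
        (by positivity) (hΛle t (by omega)) (sq_nonneg a) (ih (by omega) k)
  intro k
  have ha1 : a ^ 2 ≤ 1 :=
    (pow_le_pow_left₀ ha0 (hax k) 2).trans (sq_dotProduct_le_one (hxunit j) (hxsunit k))
  refine (hvar T le_rfl k).trans ?_
  gcongr ?_ + _
  calc a ^ 2 / ((T : ℝ) + 1) ≤ 1 / (1 * T + 1) := by rw [one_mul]; gcongr
    _ ≤ 1 / (a ^ 2 * T + 1) := by gcongr
end

section
/- Let d = 2, Σ₀ = I₂, σ = 1, x₁ = (1/√2, 1/√2), x₂ = (0, 1), x_* = (1, 0), and for S ⊆ {1,2} define f(S) = x_*ᵀ (I₂ + Σ_{i∈S} x_i x_iᵀ)^{-1} x_*. Then f(∅) = 1, f({1}) = 3/4, f({2}) = 1, and f({1,2}) = 5/7. In particular f({2}) − f(∅) = 0 > −1/28 = f({1,2}) − f({1}), so f violates the supermodularity inequality f(S₁ ∪ {j}) − f(S₁) ≤ f(S₂ ∪ {j}) − f(S₂) at S₁ = ∅ ⊆ S₂ = {1} and j = 2; hence f is not supermodular. -/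
open Matrix

/-- For a `2 × 2` matrix, the quadratic form of the inverse at the first basis vector is the
opposite diagonal entry divided by the determinant. -/
theorem dotProduct_inv_mulVec_fin_two {K : Type*} [Field K] (M : Matrix (Fin 2) (Fin 2) K) :
    ![(1 : K), 0] ⬝ᵥ M⁻¹ *ᵥ ![1, 0] = M 1 1 / (M 0 0 * M 1 1 - M 0 1 * M 1 0) := by
  simp [Matrix.inv_def, Matrix.adjugate_fin_two, Matrix.det_fin_two, Matrix.mulVec,
    dotProduct, Fin.sum_univ_two, div_eq_inv_mul]

/-- **The G-optimal design objective is not supermodular.**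
With `d = 2`, `Σ₀ = I₂`, `σ = 1`, `x₁ = (1/√2, 1/√2)`, `x₂ = (0, 1)`, `x⁎ = (1, 0)`, and
`f(S) = x⁎ᵀ (I₂ + Σ_{i∈S} x_i x_iᵀ)⁻¹ x⁎` for `S ⊆ {1,2}` (indices `0,1` in Lean):
`f(∅) = 1`, `f({1}) = 3/4`, `f({2}) = 1`, `f({1,2}) = 5/7`; in particular
`f({2}) − f(∅) = 0 > −1/28 = f({1,2}) − f({1})`, which violates the supermodularity
inequality at `S₁ = ∅ ⊆ S₂ = {1}`, `j = 2`; hence `f` is not supermodular. -/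
theorem stmt_6 (x : Fin 2 → Fin 2 → ℝ)
    (hx0 : x 0 = ![1 / Real.sqrt 2, 1 / Real.sqrt 2])
    (hx1 : x 1 = ![(0 : ℝ), 1])
    (xs : Fin 2 → ℝ) (hxs : xs = ![(1 : ℝ), 0])
    (f : Finset (Fin 2) → ℝ)
    (hf : ∀ S : Finset (Fin 2),
      f S = xs ⬝ᵥ ((1 : Matrix (Fin 2) (Fin 2) ℝ) + ∑ i ∈ S, vecMulVec (x i) (x i))⁻¹ *ᵥ xs) :
    f ∅ = 1 ∧ f {0} = 3 / 4 ∧ f {1} = 1 ∧ f {0, 1} = 5 / 7 ∧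
    (f {1} - f ∅ = 0 ∧ f {0, 1} - f {0} = -(1 / 28) ∧
      f {0, 1} - f {0} < f {1} - f ∅) ∧
    ¬ (∀ (S₁ S₂ : Finset (Fin 2)) (j : Fin 2), S₁ ⊆ S₂ → j ∉ S₂ →
        f (insert j S₁) - f S₁ ≤ f (insert j S₂) - f S₂) := by
  subst hxs
  have hsqrt : (Real.sqrt 2)⁻¹ * (Real.sqrt 2)⁻¹ = 1 / 2 := by
    rw [← mul_inv, Real.mul_self_sqrt (by norm_num), one_div]
  simp only [dotProduct_inv_mulVec_fin_two] at hf
  have h_empty : f ∅ = 1 := by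
    rw [hf]; simp
  have h_zero : f {0} = 3 / 4 := by
    rw [hf]; simp [hx0, hsqrt]; norm_num
  have h_one : f {1} = 1 := by
    rw [hf]; simp [hx1]
  have h_both : f {0, 1} = 5 / 7 := by
    rw [hf, Finset.sum_pair (by decide)]
    simp [hx0, hx1, hsqrt]; norm_num
  refine ⟨h_empty, h_zero, h_one, h_both, ⟨?_, ?_, ?_⟩, fun h => ?_⟩
  · rw [h_one, h_empty]; norm_num
  · rw [h_both, h_zero]; norm_num
  · rw [h_one, h_empty, h_both, h_zero]; norm_num
  · have h_ins := h ∅ {0} 1 (Finset.empty_subset _) (by decide)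
    rw [Finset.pair_comm, insert_empty_eq, h_one, h_empty, h_both, h_zero] at h_ins
    norm_num at h_ins
end

section
/- Let T ≥ 1, α ∈ [0,1], and let x_*, X_1, …, X_T ∈ ℝ^d be unit vectors with x_*ᵀ X_ℓ ≥ α for all ℓ ∈ {1,…,T}. Set Λ_{T+1} = I_d + Σ_{ℓ=1}^T X_ℓ X_ℓᵀ, and suppose there is a unit eigenvector v of Λ_{T+1} associated with its largest eigenvalue such that x_*ᵀ v ≥ α. Then x_*ᵀ Λ_{T+1}^{-1} x_* ≤ 1/(α² T + 1) + (1 − α²). -/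
open Matrix

namespace Matrix

variable {n : Type*} [Fintype n] [DecidableEq n]

/-- The Rayleigh quotient of a real symmetric matrix is at most its largest eigenvalue. -/
theorem IsHermitian.dotProduct_mulVec_le_iSup_eigenvalues {A : Matrix n n ℝ}
    (hA : A.IsHermitian) (x : n → ℝ) :
    x ⬝ᵥ A *ᵥ x ≤ (⨆ i, hA.eigenvalues i) * (x ⬝ᵥ x) := by
  set r := ⨆ i, hA.eigenvalues i
  have hB : (algebraMap ℝ (Matrix n n ℝ) r - A).IsHermitian := by
    refine IsHermitian.sub ?_ hA
    simp [IsHermitian, algebraMap_eq_diagonal]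
  have hpos : (algebraMap ℝ (Matrix n n ℝ) r - A).PosSemidef := by
    rw [hB.posSemidef_iff_eigenvalues_nonneg]
    intro i
    have hi := hB.eigenvalues_mem_spectrum_real i
    rw [← spectrum.singleton_sub_eq, Set.singleton_sub, hA.spectrum_real_eq_range_eigenvalues] at hi
    obtain ⟨_, ⟨j, rfl⟩, hj⟩ := hi
    have hjr : hA.eigenvalues j ≤ r := le_ciSup (Set.finite_range _).bddAbove j
    simp only [Pi.zero_apply]
    linarith
  have h := hpos.dotProduct_mulVec_nonneg x
  rw [Algebra.algebraMap_eq_smul_one] at h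
  simp only [star_trivial, sub_mulVec, smul_mulVec, one_mulVec, dotProduct_sub,
    dotProduct_smul, smul_eq_mul] at h
  linarith

/-- If `v` is a unit eigenvector of `1 + S`, then on the component of `x` orthogonal to `v`
the quadratic form of `(1 + S)⁻¹` is bounded by the squared norm. -/
theorem PosSemidef.dotProduct_one_add_inv_mulVec_le {S : Matrix n n ℝ} (hS : S.PosSemidef)
    {r : ℝ} (hr : r ≠ 0) {v : n → ℝ} (hv : v ⬝ᵥ v = 1) (hSv : (1 + S) *ᵥ v = r • v)
    (x : n → ℝ) :
    x ⬝ᵥ (1 + S)⁻¹ *ᵥ x ≤ (x ⬝ᵥ v) ^ 2 / r + (x ⬝ᵥ x - (x ⬝ᵥ v) ^ 2) := by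
  have hunit : IsUnit (1 + S).det :=
    (isUnit_iff_isUnit_det _).1 (PosDef.one.add_posSemidef hS).isUnit
  set c := x ⬝ᵥ v with hc
  set y := (1 + S)⁻¹ *ᵥ x
  have hy : (1 + S) *ᵥ y = x := by
    rw [mulVec_mulVec, mul_nonsing_inv _ hunit, one_mulVec]
  have hsymm : (1 + S)ᵀ = 1 + S := by
    simpa [conjTranspose_eq_transpose_of_trivial] using (isHermitian_one.add hS.isHermitian).eq
  have hyv : y ⬝ᵥ v = c / r := by
    have h : v ⬝ᵥ (1 + S) *ᵥ y = r * (y ⬝ᵥ v) := by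
      rw [dotProduct_mulVec, ← mulVec_transpose, hsymm, hSv, smul_dotProduct, smul_eq_mul,
        dotProduct_comm v y]
    rw [hy, dotProduct_comm, ← hc] at h
    rw [h]
    field_simp
  set z := y - (c / r) • v with hz
  set w := x - c • v with hw
  have hSz : S *ᵥ z = w - z := by
    have h : (1 + S) *ᵥ z = w := by
      rw [hz, mulVec_sub, mulVec_smul, hy, hSv, smul_smul, div_mul_cancel₀ _ hr]
    rw [add_mulVec, one_mulVec] at h
    rw [← h, add_sub_cancel_left]
  have h1 : 0 ≤ z ⬝ᵥ S *ᵥ z := by simpa using hS.dotProduct_mulVec_nonneg z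
  have h2 : 0 ≤ (S *ᵥ z) ⬝ᵥ (S *ᵥ z) := by simpa using dotProduct_star_self_nonneg (S *ᵥ z)
  have hww : w ⬝ᵥ w = x ⬝ᵥ x - c ^ 2 := by
    simp only [hw, sub_dotProduct, dotProduct_sub, smul_dotProduct, dotProduct_smul, smul_eq_mul,
      hv, dotProduct_comm v x, ← hc]
    ring
  have hwz : w ⬝ᵥ z = x ⬝ᵥ y - c ^ 2 / r := by
    simp only [hw, hz, sub_dotProduct, dotProduct_sub, smul_dotProduct, dotProduct_smul,
      smul_eq_mul, hv, dotProduct_comm v y, hyv, ← hc]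
    ring
  rw [hSz] at h1 h2
  simp only [sub_dotProduct, dotProduct_sub, dotProduct_comm z w] at h1 h2
  linarith

end Matrix

/-- **Posterior variance bound from alignment with the top eigenvector.**
Let `T ≥ 1`, `α ∈ [0,1]`, and let `x⁎, X_1, …, X_T ∈ ℝ^d` be unit vectors with
`x⁎ᵀ X_ℓ ≥ α` for all `ℓ`. Set `Λ_{T+1} = I_d + Σ_{ℓ=1}^T X_ℓ X_ℓᵀ`, and suppose there is
a unit eigenvector `v` of `Λ_{T+1}` associated with its largest eigenvalue such that
`x⁎ᵀ v ≥ α`. Then `x⁎ᵀ Λ_{T+1}⁻¹ x⁎ ≤ 1/(α² T + 1) + (1 − α²)`. -/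
theorem stmt_12 {d : ℕ} (T : ℕ) (hT : 1 ≤ T) (α : ℝ) (hα0 : 0 ≤ α) (hα1 : α ≤ 1)
    (xs : Fin d → ℝ) (hxs : xs ⬝ᵥ xs = 1)
    (X : Fin T → Fin d → ℝ) (hXunit : ∀ ℓ, X ℓ ⬝ᵥ X ℓ = 1)
    (hXdot : ∀ ℓ, α ≤ xs ⬝ᵥ X ℓ)
    (hΛ : ((1 : Matrix (Fin d) (Fin d) ℝ) + ∑ ℓ, vecMulVec (X ℓ) (X ℓ)).IsHermitian)
    (hv : ∃ v : Fin d → ℝ, v ⬝ᵥ v = 1 ∧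
      ((1 : Matrix (Fin d) (Fin d) ℝ) + ∑ ℓ, vecMulVec (X ℓ) (X ℓ)) *ᵥ v =
        (⨆ i, hΛ.eigenvalues i) • v ∧
      α ≤ xs ⬝ᵥ v) :
    xs ⬝ᵥ ((1 : Matrix (Fin d) (Fin d) ℝ) + ∑ ℓ, vecMulVec (X ℓ) (X ℓ))⁻¹ *ᵥ xs ≤
      1 / (α ^ 2 * T + 1) + (1 - α ^ 2) := by
  obtain ⟨v, hvv, hΛv, hαv⟩ := hv
  set r := ⨆ i, hΛ.eigenvalues i
  have hS : (∑ ℓ, vecMulVec (X ℓ) (X ℓ)).PosSemidef :=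
    posSemidef_sum _ fun ℓ _ => by simpa using posSemidef_vecMulVec_self_star (X ℓ)
  have hr : α ^ 2 * T + 1 ≤ r := by
    have h := hΛ.dotProduct_mulVec_le_iSup_eigenvalues xs
    rw [hxs, mul_one, add_mulVec, one_mulVec, dotProduct_add, hxs, sum_mulVec, dotProduct_sum] at h
    have hsum : ∑ _ℓ : Fin T, α ^ 2 ≤ ∑ ℓ, xs ⬝ᵥ vecMulVec (X ℓ) (X ℓ) *ᵥ xs := by
      refine Finset.sum_le_sum fun ℓ _ => ?_
      rw [vecMulVec_mulVec, dotProduct_smul, dotProduct_comm (X ℓ) xs]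
      simp only [MulOpposite.smul_eq_mul_unop, MulOpposite.unop_op]
      nlinarith [hXdot ℓ]
    rw [Finset.sum_const, Finset.card_univ, Fintype.card_fin, nsmul_eq_mul] at hsum
    linarith
  have hm : 1 ≤ α ^ 2 * T + 1 := le_add_of_nonneg_left (by positivity)
  have hr1 : 1 ≤ r := hm.trans hr
  have hbound := hS.dotProduct_one_add_inv_mulVec_le (by positivity) hvv hΛv xs
  rw [hxs] at hbound
  have hsq : α ^ 2 ≤ (xs ⬝ᵥ v) ^ 2 := by gcongr
  have hinv : 1 / r ≤ 1 / (α ^ 2 * T + 1) := by gcongr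
  have hinv1 : 1 / r ≤ 1 := (div_le_one (by positivity)).2 hr1
  have hinv0 : 0 ≤ 1 / r := by positivity
  have hα2 : α ^ 2 ≤ 1 := pow_le_one₀ hα0 hα1
  calc _ ≤ (xs ⬝ᵥ v) ^ 2 / r + (1 - (xs ⬝ᵥ v) ^ 2) := hbound
    _ = 1 - (xs ⬝ᵥ v) ^ 2 * (1 - 1 / r) := by ring
    _ ≤ 1 - α ^ 2 * (1 - 1 / r) := by
      gcongr
    _ ≤ 1 / r + (1 - α ^ 2) := by nlinarith
    _ ≤ 1 / (α ^ 2 * T + 1) + (1 - α ^ 2) := by gcongr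
end

section
/- Let d ≥ 1, t ≥ 1, α ∈ [0,1], β > 0 with t ≤ α² / ((β + √2) β d). Let Λ = Σ_{i=1}^d λ_i v_i v_iᵀ with (v_1, …, v_d) an orthonormal basis of ℝ^d, λ_1 the largest eigenvalue, λ_i ≥ 1 for every i, and λ_1 ≤ t. Let x_*, x, y ∈ ℝ^d be unit vectors such that x_*ᵀ v_1 ≥ α, xᵀ v_1 ≥ α, |v_1ᵀ y| ≤ β, and |x_*ᵀ v_i| ≤ β and |xᵀ v_i| ≤ β for all i ∈ {2,…,d}. Then (x_*ᵀ Λ^{-1} x)² ≥ 2 (x_*ᵀ Λ^{-1} y)², and consequently x_*ᵀ (Λ + x xᵀ)^{-1} x_* ≤ x_*ᵀ (Λ + y yᵀ)^{-1} x_*; that is, the greedy G-optimal rule prefers labeling x over y. -/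
open Matrix

/-- The rank-one projections onto the vectors of an orthonormal basis sum to the identity. -/
theorem sum_vecMulVec_of_orthonormal {n : Type*} [Fintype n] [DecidableEq n] {v : n → n → ℝ}
    (hon : ∀ i j, v i ⬝ᵥ v j = if i = j then 1 else 0) :
    ∑ i, vecMulVec (v i) (v i) = 1 := by
  have h : Matrix.of v * (Matrix.of v)ᵀ = 1 := by
    ext i j
    simpa [Matrix.mul_apply, dotProduct, Matrix.one_apply] using hon i j
  rw [← mul_eq_one_comm.mp h]
  ext i j
  simp [Matrix.sum_apply, Matrix.mul_apply, vecMulVec_apply]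

theorem sum_smul_vecMulVec_mul {n : Type*} [Fintype n] [DecidableEq n] {v : n → n → ℝ}
    (hon : ∀ i j, v i ⬝ᵥ v j = if i = j then 1 else 0) (a b : n → ℝ) :
    (∑ i, a i • vecMulVec (v i) (v i)) * (∑ i, b i • vecMulVec (v i) (v i)) =
      ∑ i, (a i * b i) • vecMulVec (v i) (v i) := by
  rw [Finset.sum_mul_sum]
  refine Finset.sum_congr rfl fun i _ => ?_
  rw [Finset.sum_eq_single i]
  · simp [vecMulVec_mul_vecMulVec, hon, smul_smul, mul_comm]
  · intro j _ hj
    simp [vecMulVec_mul_vecMulVec, hon, hj.symm]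
  · simp

theorem sum_smul_vecMulVec_mul_inv {n : Type*} [Fintype n] [DecidableEq n] {v : n → n → ℝ}
    (hon : ∀ i j, v i ⬝ᵥ v j = if i = j then 1 else 0) {a : n → ℝ} (ha : ∀ i, a i ≠ 0) :
    (∑ i, a i • vecMulVec (v i) (v i)) * (∑ i, (a i)⁻¹ • vecMulVec (v i) (v i)) = 1 := by
  simp [sum_smul_vecMulVec_mul hon, ha, sum_vecMulVec_of_orthonormal hon]

theorem dotProduct_sum_smul_vecMulVec_mulVec {n : Type*} [Fintype n] (v : n → n → ℝ)
    (a : n → ℝ) (p q : n → ℝ) :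
    p ⬝ᵥ (∑ i, a i • vecMulVec (v i) (v i)) *ᵥ q = ∑ i, a i * (p ⬝ᵥ v i) * (v i ⬝ᵥ q) := by
  rw [Matrix.sum_mulVec, dotProduct_sum]
  refine Finset.sum_congr rfl fun i _ => ?_
  simp [smul_mulVec, vecMulVec_mulVec, mul_comm, mul_left_comm]

/-- The **Sherman–Morrison formula**, in a form that only needs a right inverse. -/
theorem inv_add_vecMulVec {n : Type*} [Fintype n] [DecidableEq n] {A B : Matrix n n ℝ}
    (h : A * B = 1) (u w : n → ℝ) (hs : 1 + w ⬝ᵥ B *ᵥ u ≠ 0) :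
    (A + vecMulVec u w)⁻¹ =
      B - (1 + w ⬝ᵥ B *ᵥ u)⁻¹ • vecMulVec (B *ᵥ u) (w ᵥ* B) := by
  apply Matrix.inv_eq_right_inv
  rw [add_mul, mul_sub, mul_sub, h, mul_smul_comm, mul_smul_comm, mul_vecMulVec, mulVec_mulVec, h,
    one_mulVec, vecMulVec_mul, vecMulVec_mul_vecMulVec, vecMulVec_smul, smul_smul]
  match_scalars
  · simp
  · field_simp
    ring

/-- Sherman–Morrison for the quadratic form of a symmetric rank-one update. -/
theorem dotProduct_inv_add_vecMulVec_mulVec_s15 {n : Type*} [Fintype n] [DecidableEq n]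
    {A B : Matrix n n ℝ} (h : A * B = 1) (hB : Bᵀ = B) (p u : n → ℝ)
    (hs : 1 + u ⬝ᵥ B *ᵥ u ≠ 0) :
    p ⬝ᵥ (A + vecMulVec u u)⁻¹ *ᵥ p =
      p ⬝ᵥ B *ᵥ p - (p ⬝ᵥ B *ᵥ u) ^ 2 / (1 + u ⬝ᵥ B *ᵥ u) := by
  have hu : u ᵥ* B = B *ᵥ u := by rw [← mulVec_transpose, hB]
  rw [inv_add_vecMulVec h u u hs, hu, sub_mulVec, dotProduct_sub, smul_mulVec, vecMulVec_mulVec,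
    dotProduct_smul]
  simp [dotProduct_comm (B *ᵥ u) p]
  field_simp

theorem abs_dotProduct_le_one {n : Type*} [Fintype n] {p q : n → ℝ}
    (hp : p ⬝ᵥ p = 1) (hq : q ⬝ᵥ q = 1) : |p ⬝ᵥ q| ≤ 1 := by
  rw [← sq_le_one_iff_abs_le_one]
  have h := Finset.sum_mul_sq_le_sq_mul_sq Finset.univ p q
  simp only [dotProduct, ← sq] at hp hq
  simpa [hp, hq, dotProduct] using h

/-- **Greedy example-selection lemma.**
Let `d ≥ 1`, `t ≥ 1`, `α ∈ [0,1]`, `β > 0` with `t ≤ α² / ((β + √2) β d)`. Let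
`Λ = Σ_{i=1}^d λ_i v_i v_iᵀ` with `(v_1, …, v_d)` an orthonormal basis of `ℝ^d`
(distinguished top index `i₀`), `λ_{i₀}` the largest eigenvalue, `λ_i ≥ 1` for all `i`,
and `λ_{i₀} ≤ t`. Let `x⁎, x, y ∈ ℝ^d` be unit vectors with `x⁎ᵀ v_{i₀} ≥ α`,
`xᵀ v_{i₀} ≥ α`, `|v_{i₀}ᵀ y| ≤ β`, and `|x⁎ᵀ v_i| ≤ β`, `|xᵀ v_i| ≤ β` for all
`i ≠ i₀`. Then `(x⁎ᵀ Λ⁻¹ x)² ≥ 2 (x⁎ᵀ Λ⁻¹ y)²`, and consequently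
`x⁎ᵀ (Λ + x xᵀ)⁻¹ x⁎ ≤ x⁎ᵀ (Λ + y yᵀ)⁻¹ x⁎`: the greedy G-optimal rule prefers
labeling `x` over `y`. -/
theorem stmt_15 {d : ℕ} (hd : 1 ≤ d) (t : ℝ) (ht : 1 ≤ t)
    (α β : ℝ) (hα0 : 0 ≤ α) (hα1 : α ≤ 1) (hβ : 0 < β)
    (htub : t ≤ α ^ 2 / ((β + Real.sqrt 2) * β * d))
    (lam : Fin d → ℝ) (v : Fin d → Fin d → ℝ)
    (hon : ∀ i j, v i ⬝ᵥ v j = if i = j then 1 else 0)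
    (i₀ : Fin d) (hmax : ∀ i, lam i ≤ lam i₀) (hlam : ∀ i, 1 ≤ lam i)
    (hlamt : lam i₀ ≤ t)
    (xs x y : Fin d → ℝ) (hxs : xs ⬝ᵥ xs = 1) (hx : x ⬝ᵥ x = 1) (hy : y ⬝ᵥ y = 1)
    (hxsv : α ≤ xs ⬝ᵥ v i₀) (hxv : α ≤ x ⬝ᵥ v i₀) (hvy : |v i₀ ⬝ᵥ y| ≤ β)
    (hxsβ : ∀ i, i ≠ i₀ → |xs ⬝ᵥ v i| ≤ β)
    (hxβ : ∀ i, i ≠ i₀ → |x ⬝ᵥ v i| ≤ β) :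
    2 * (xs ⬝ᵥ (∑ i, lam i • vecMulVec (v i) (v i))⁻¹ *ᵥ y) ^ 2 ≤
      (xs ⬝ᵥ (∑ i, lam i • vecMulVec (v i) (v i))⁻¹ *ᵥ x) ^ 2 ∧
    xs ⬝ᵥ ((∑ i, lam i • vecMulVec (v i) (v i)) + vecMulVec x x)⁻¹ *ᵥ xs ≤
      xs ⬝ᵥ ((∑ i, lam i • vecMulVec (v i) (v i)) + vecMulVec y y)⁻¹ *ᵥ xs := by
  have hone : ∀ i, v i ⬝ᵥ v i = 1 := fun i => by simp [hon]
  have hlam0 : ∀ i, 0 < lam i := fun i => one_pos.trans_le (hlam i)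
  have hl0 : ∀ i, 0 ≤ (lam i)⁻¹ := fun i => (inv_pos.mpr (hlam0 i)).le
  have hl1 : ∀ i, (lam i)⁻¹ ≤ 1 := fun i => inv_le_one_of_one_le₀ (hlam i)
  have hAB := sum_smul_vecMulVec_mul_inv hon fun i => (hlam0 i).ne'
  have hinv := Matrix.inv_eq_right_inv hAB
  have hform := dotProduct_sum_smul_vecMulVec_mulVec v fun i => (lam i)⁻¹
  have hsymm : (∑ i, (lam i)⁻¹ • vecMulVec (v i) (v i))ᵀ =
      ∑ i, (lam i)⁻¹ • vecMulVec (v i) (v i) := by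
    simp [Matrix.transpose_sum, transpose_vecMulVec]
  rw [hinv]
  set A := ∑ i, lam i • vecMulVec (v i) (v i)
  set B := ∑ i, (lam i)⁻¹ • vecMulVec (v i) (v i)
  have hBy : |xs ⬝ᵥ B *ᵥ y| ≤ d * β := by
    rw [hform]
    calc |∑ i, (lam i)⁻¹ * (xs ⬝ᵥ v i) * (v i ⬝ᵥ y)|
        ≤ ∑ i, |(lam i)⁻¹ * (xs ⬝ᵥ v i) * (v i ⬝ᵥ y)| := Finset.abs_sum_le_sum_abs _ _
      _ ≤ ∑ _i : Fin d, β := Finset.sum_le_sum fun i _ => ?_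
      _ = d * β := by simp
    rw [mul_assoc, abs_mul, abs_mul, abs_of_nonneg (hl0 i)]
    have hprod : |xs ⬝ᵥ v i| * |v i ⬝ᵥ y| ≤ β := by
      rcases eq_or_ne i i₀ with rfl | hi
      · simpa using mul_le_mul (abs_dotProduct_le_one hxs (hone i)) hvy (abs_nonneg _) zero_le_one
      · simpa using mul_le_mul (hxsβ i hi) (abs_dotProduct_le_one (hone i) hy) (abs_nonneg _) hβ.le
    exact (mul_le_of_le_one_left (by positivity) (hl1 i)).trans hprod
  have hBx : α ^ 2 / t - d * β ^ 2 ≤ xs ⬝ᵥ B *ᵥ x := by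
    rw [hform]
    have htop : α ^ 2 / t ≤ (lam i₀)⁻¹ * (xs ⬝ᵥ v i₀) * (v i₀ ⬝ᵥ x) := by
      have h1 : α ^ 2 ≤ (xs ⬝ᵥ v i₀) * (v i₀ ⬝ᵥ x) := by
        rw [dotProduct_comm (v i₀) x, sq]
        exact mul_le_mul hxsv hxv hα0 (hα0.trans hxsv)
      have h2 : t⁻¹ ≤ (lam i₀)⁻¹ := inv_anti₀ (hlam0 i₀) hlamt
      rw [div_eq_inv_mul, mul_assoc]
      exact mul_le_mul h2 h1 (sq_nonneg α) (hl0 i₀)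
    have htop0 : 0 ≤ α ^ 2 / t := by positivity
    have hterm : ∀ i, 0 ≤ (lam i)⁻¹ * (xs ⬝ᵥ v i) * (v i ⬝ᵥ x) + β ^ 2 := by
      intro i
      rcases eq_or_ne i i₀ with rfl | hi
      · linarith [sq_nonneg β]
      · have h1 : |xs ⬝ᵥ v i| * |v i ⬝ᵥ x| ≤ β ^ 2 := by
          rw [dotProduct_comm (v i) x, sq]
          exact mul_le_mul (hxsβ i hi) (hxβ i hi) (abs_nonneg _) hβ.le
        have h2 : |(lam i)⁻¹ * (xs ⬝ᵥ v i) * (v i ⬝ᵥ x)| ≤ β ^ 2 := by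
          rw [mul_assoc, abs_mul, abs_mul, abs_of_nonneg (hl0 i)]
          exact (mul_le_of_le_one_left (by positivity) (hl1 i)).trans h1
        linarith [(abs_le.mp h2).1]
    have hsum := Finset.single_le_sum (fun i _ => hterm i) (Finset.mem_univ i₀)
    rw [Finset.sum_add_distrib] at hsum
    simp only [Finset.sum_const, Finset.card_univ, Fintype.card_fin, nsmul_eq_mul] at hsum
    linarith [sq_nonneg β]
  have hthreshold : Real.sqrt 2 * (d * β) ≤ α ^ 2 / t - d * β ^ 2 := by
    have hd0 : (0 : ℝ) < d := by exact_mod_cast hd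
    have hden : 0 < (β + Real.sqrt 2) * β * d := by positivity
    have h1 : (β + Real.sqrt 2) * β * d ≤ α ^ 2 / t := by
      rw [le_div_iff₀ (by linarith)]
      rw [le_div_iff₀ hden] at htub
      linarith
    linarith
  have hmain : 2 * (xs ⬝ᵥ B *ᵥ y) ^ 2 ≤ (xs ⬝ᵥ B *ᵥ x) ^ 2 := by
    have h1 : Real.sqrt 2 * |xs ⬝ᵥ B *ᵥ y| ≤ xs ⬝ᵥ B *ᵥ x :=
      ((mul_le_mul_of_nonneg_left hBy (Real.sqrt_nonneg 2)).trans hthreshold).trans hBx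
    have h2 := pow_le_pow_left₀ (by positivity) h1 2
    rwa [mul_pow, Real.sq_sqrt zero_le_two, sq_abs] at h2
  refine ⟨hmain, ?_⟩
  have hnonneg : ∀ u, 0 ≤ u ⬝ᵥ B *ᵥ u := fun u => by
    rw [hform]
    refine Finset.sum_nonneg fun i _ => ?_
    rw [dotProduct_comm (v i) u, mul_assoc]
    exact mul_nonneg (hl0 i) (mul_self_nonneg _)
  have hxle : x ⬝ᵥ B *ᵥ x ≤ 1 := by
    calc x ⬝ᵥ B *ᵥ x = ∑ i, (lam i)⁻¹ * ((x ⬝ᵥ v i) * (v i ⬝ᵥ x)) := by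
          rw [hform]; simp only [mul_assoc]
      _ ≤ ∑ i, (1 : ℝ) * (x ⬝ᵥ v i) * (v i ⬝ᵥ x) := Finset.sum_le_sum fun i _ => by
          rw [one_mul, dotProduct_comm (v i) x]
          exact mul_le_of_le_one_left (mul_self_nonneg _) (hl1 i)
      _ = 1 := by
          rw [← dotProduct_sum_smul_vecMulVec_mulVec v fun _ => 1]
          simp [sum_vecMulVec_of_orthonormal hon, hx]
  have hx0 := hnonneg x
  have hy0 := hnonneg y
  rw [dotProduct_inv_add_vecMulVec_mulVec_s15 hAB hsymm xs x (by positivity),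
    dotProduct_inv_add_vecMulVec_mulVec_s15 hAB hsymm xs y (by positivity)]
  refine sub_le_sub_left ?_ _
  calc (xs ⬝ᵥ B *ᵥ y) ^ 2 / (1 + y ⬝ᵥ B *ᵥ y)
      ≤ (xs ⬝ᵥ B *ᵥ y) ^ 2 := div_le_self (sq_nonneg _) (by linarith)
    _ ≤ (xs ⬝ᵥ B *ᵥ x) ^ 2 / 2 := by linarith
    _ ≤ (xs ⬝ᵥ B *ᵥ x) ^ 2 / (1 + x ⬝ᵥ B *ᵥ x) := by
        gcongr
        linarith
end
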